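/- arXiv:2008.09525 — 7 statements merged into one kernel-verified Lean document; each statement's English description precedes it below -/
import Mathlib

section
/- Let A be a regular Hopf coquasigroup over a field k and let f be a faithful linear functional on A. Then for every a ∈ A there exists an element e ∈ A such that a = a₍₁₎ f(a₍₂₎ e) (summation implicit); that is, a = (id ⊗ f)(Δ(a)(1 ⊗ e)). -/
open TensorProduct

/-- A regular Hopf coquasigroup over a field `k`: a unital associative `k`-algebra `A`
with a (not necessarily coassociative) coproduct `comul : A →ₐ[k] A ⊗[k] A`, a counit
`counit : A →ₐ[k] k`, and a bijective antipode `antipode : A ≃ₗ[k] A` which is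
antimultiplicative, anticomultiplicative, and satisfies the quasigroup antipode
identities. -/
structure RegularHopfCoquasigroup (k A : Type*) [Field k] [Ring A] [Algebra k A] where
  comul : A →ₐ[k] A ⊗[k] A
  counit : A →ₐ[k] k
  antipode : A ≃ₗ[k] A
  /-- `(ε ⊗ id) ∘ Δ = id` -/
  counit_comul_left : ∀ a : A,
    (TensorProduct.lid k A) ((LinearMap.rTensor A counit.toLinearMap) (comul a)) = a
  /-- `(id ⊗ ε) ∘ Δ = id` -/
  counit_comul_right : ∀ a : A,
    (TensorProduct.rid k A) ((LinearMap.lTensor A counit.toLinearMap) (comul a)) = a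
  /-- `S(ab) = S(b)S(a)` -/
  antipode_mul : ∀ a b : A, antipode (a * b) = antipode b * antipode a
  /-- `S(1) = 1` -/
  antipode_one : antipode (1 : A) = 1
  /-- `Δ ∘ S = (S ⊗ S) ∘ flip ∘ Δ` -/
  antipode_comul : ∀ a : A,
    comul (antipode a) =
      (TensorProduct.map antipode.toLinearMap antipode.toLinearMap)
        ((TensorProduct.comm k A A) (comul a))
  /-- `S(a₍₁₎)a₍₂₎₍₁₎ ⊗ a₍₂₎₍₂₎ = 1 ⊗ a` -/
  quasi₁ : ∀ a : A,
    (LinearMap.rTensor A (LinearMap.mul' k A))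
      ((TensorProduct.assoc k A A A).symm
        ((LinearMap.rTensor (A ⊗[k] A) antipode.toLinearMap)
          ((LinearMap.lTensor A comul.toLinearMap) (comul a)))) = (1 : A) ⊗ₜ[k] a
  /-- `a₍₁₎S(a₍₂₎₍₁₎) ⊗ a₍₂₎₍₂₎ = 1 ⊗ a` -/
  quasi₂ : ∀ a : A,
    (LinearMap.rTensor A (LinearMap.mul' k A))
      ((TensorProduct.assoc k A A A).symm
        ((LinearMap.lTensor A (LinearMap.rTensor A antipode.toLinearMap))
          ((LinearMap.lTensor A comul.toLinearMap) (comul a)))) = (1 : A) ⊗ₜ[k] a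
  /-- `a₍₁₎₍₁₎ ⊗ S(a₍₁₎₍₂₎)a₍₂₎ = a ⊗ 1` -/
  quasi₃ : ∀ a : A,
    (LinearMap.lTensor A (LinearMap.mul' k A))
      ((TensorProduct.assoc k A A A)
        ((LinearMap.rTensor A (LinearMap.lTensor A antipode.toLinearMap))
          ((LinearMap.rTensor A comul.toLinearMap) (comul a)))) = a ⊗ₜ[k] (1 : A)
  /-- `a₍₁₎₍₁₎ ⊗ a₍₁₎₍₂₎S(a₍₂₎) = a ⊗ 1` -/
  quasi₄ : ∀ a : A,
    (LinearMap.lTensor A (LinearMap.mul' k A))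
      ((TensorProduct.assoc k A A A)
        ((LinearMap.lTensor (A ⊗[k] A) antipode.toLinearMap)
          ((LinearMap.rTensor A comul.toLinearMap) (comul a)))) = a ⊗ₜ[k] (1 : A)

variable {k A : Type*} [Field k] [Ring A] [Algebra k A]

/-- `(id ⊗ f)` on `A ⊗[k] A`, composed with `A ⊗ k ≅ A`; so `idT f (a ⊗ b) = f b • a`,
i.e. in Sweedler notation `idT f (Δ a) = a₍₁₎ f(a₍₂₎)`. -/
noncomputable def idT (f : A →ₗ[k] k) : A ⊗[k] A →ₗ[k] A :=
  (TensorProduct.rid k A).toLinearMap ∘ₗ LinearMap.lTensor A f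

/-- `(f ⊗ id)` on `A ⊗[k] A`, composed with `k ⊗ A ≅ A`; so `Tid f (a ⊗ b) = f a • b`,
i.e. in Sweedler notation `Tid f (Δ a) = f(a₍₁₎) a₍₂₎`. -/
noncomputable def Tid (f : A →ₗ[k] k) : A ⊗[k] A →ₗ[k] A :=
  (TensorProduct.lid k A).toLinearMap ∘ₗ LinearMap.rTensor A f

/-- A linear functional `f` on `A` is faithful if `f(a·) = 0` implies `a = 0` and
`f(·a) = 0` implies `a = 0`. -/
def Faithful (f : A →ₗ[k] k) : Prop :=
  (∀ a : A, (∀ b : A, f (a * b) = 0) → a = 0) ∧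
  (∀ a : A, (∀ b : A, f (b * a) = 0) → a = 0)

/-- A left integral: a nonzero functional `φ` with `a₍₁₎ φ(a₍₂₎) = φ(a)·1`. -/
def IsLeftIntegral (H : RegularHopfCoquasigroup k A) (φ : A →ₗ[k] k) : Prop :=
  φ ≠ 0 ∧ ∀ a : A, idT φ (H.comul a) = φ a • (1 : A)

/-- A right integral: a nonzero functional `ψ` with `ψ(a₍₁₎) a₍₂₎ = ψ(a)·1`. -/
def IsRightIntegral (H : RegularHopfCoquasigroup k A) (ψ : A →ₗ[k] k) : Prop :=
  ψ ≠ 0 ∧ ∀ a : A, Tid ψ (H.comul a) = ψ a • (1 : A)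


/-- Slicing `x (1 ⊗ e)` by `f` on the right and then applying `ω` is the same as slicing `x` by `ω`
on the left, multiplying by `e` and applying `f`. -/
theorem apply_idT_mul_one_tmul (f ω : A →ₗ[k] k) (x : A ⊗[k] A) (e : A) :
    ω (idT f (x * ((1 : A) ⊗ₜ[k] e))) = f (Tid ω x * e) := by
  induction x with
  | zero => simp
  | tmul b c => simp [idT, Tid, mul_comm]
  | add x y hx hy => simp only [add_mul, map_add, hx, hy]

/-- Applying the counit to `ω(a₍₁₎) a₍₂₎` gives `ω(a)`. -/
theorem RegularHopfCoquasigroup.counit_Tid_comul (H : RegularHopfCoquasigroup k A)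
    (ω : A →ₗ[k] k) (a : A) : H.counit (Tid ω (H.comul a)) = ω a := by
  have key : ∀ x : A ⊗[k] A, H.counit (Tid ω x) = ω (idT H.counit.toLinearMap x) := by
    intro x
    induction x with
    | zero => simp
    | tmul b c => simp [idT, Tid, mul_comm]
    | add x y hx hy => simp only [map_add, hx, hy]
  rw [key]
  exact congrArg ω (H.counit_comul_right a)

/-- If `f` is a faithful linear functional on a regular Hopf coquasigroup `A`,
then for every `a ∈ A` there is `e ∈ A` with `a = a₍₁₎ f(a₍₂₎ e) = (id ⊗ f)(Δ(a)(1 ⊗ e))`. -/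
theorem stmt_0 (k A : Type*) [Field k] [Ring A] [Algebra k A]
    (H : RegularHopfCoquasigroup k A) (f : A →ₗ[k] k) (hf : Faithful f) (a : A) :
    ∃ e : A, a = idT f (H.comul a * ((1 : A) ⊗ₜ[k] e)) := by
  let T : A →ₗ[k] A :=
    idT f ∘ₗ LinearMap.mulLeft k (H.comul a) ∘ₗ TensorProduct.mk k A A 1
  suffices h : a ∈ LinearMap.range T by
    obtain ⟨e, he⟩ := h
    exact ⟨e, he.symm⟩
  by_contra h
  obtain ⟨ω, hω, hT⟩ := Submodule.exists_le_ker_of_notMem h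
  have hslice : Tid ω (H.comul a) = 0 := hf.1 _ fun e => by
    rw [← apply_idT_mul_one_tmul]
    exact hT ⟨e, rfl⟩
  apply hω
  rw [← H.counit_Tid_comul, hslice, map_zero]
end

section
/- Let A be a regular Hopf coquasigroup over a field k and let φ be a left integral on A. Then for all a, b ∈ A one has a₍₁₎ φ(a₍₂₎ S(b)) = φ(a S(b₍₁₎)) b₍₂₎ in A (summations implicit). -/
open TensorProduct

variable {k A : Type*} [Field k] [Ring A] [Algebra k A]

@[simp]
theorem idT_tmul (f : A →ₗ[k] k) (x y : A) : idT f (x ⊗ₜ[k] y) = f y • x := by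
  simp [idT]

@[simp]
theorem Tid_tmul (f : A →ₗ[k] k) (x y : A) : Tid f (x ⊗ₜ[k] y) = f x • y := by
  simp [Tid]

theorem idT_mul_tmul (f : A →ₗ[k] k) (t : A ⊗[k] A) (x y : A) :
    idT f (t * (x ⊗ₜ[k] y)) = idT f (t * ((1 : A) ⊗ₜ[k] y)) * x := by
  induction t with
  | zero => simp
  | tmul c d => simp
  | add t₁ t₂ h₁ h₂ => simp only [add_mul, map_add, h₁, h₂]

/-- The linear map `x ⊗ y ↦ (id ⊗ f)(t (1 ⊗ S x)) y`. -/
noncomputable def sliceMul (S : A →ₗ[k] A) (f : A →ₗ[k] k) (t : A ⊗[k] A) :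
    A ⊗[k] A →ₗ[k] A :=
  TensorProduct.lift
    (LinearMap.mul k A ∘ₗ idT f ∘ₗ LinearMap.mulLeft k t ∘ₗ TensorProduct.mk k A A 1 ∘ₗ S)

@[simp]
theorem sliceMul_tmul (S : A →ₗ[k] A) (f : A →ₗ[k] k) (t : A ⊗[k] A) (x y : A) :
    sliceMul S f t (x ⊗ₜ[k] y) = idT f (t * ((1 : A) ⊗ₜ[k] S x)) * y := by
  simp [sliceMul]

theorem sliceMul_assoc_tmul (S : A →ₗ[k] A) (f : A →ₗ[k] k) (t v : A ⊗[k] A) (y : A) :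
    sliceMul S f t (LinearMap.lTensor A (LinearMap.mul' k A)
        (TensorProduct.assoc k A A A (LinearMap.lTensor A S v ⊗ₜ[k] y))) =
      idT f (t * TensorProduct.map S S (TensorProduct.comm k A A v)) * y := by
  induction v with
  | zero => simp
  | tmul p q => simp [idT_mul_tmul f t (S q) (S p), mul_assoc]
  | add v₁ v₂ h₁ h₂ => simp only [TensorProduct.add_tmul, map_add, mul_add, add_mul, h₁, h₂]

theorem IsLeftIntegral.sliceMul_comul {H : RegularHopfCoquasigroup k A} {φ : A →ₗ[k] k}
    (hφ : IsLeftIntegral H φ) (a : A) (u : A ⊗[k] A) :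
    sliceMul H.antipode.toLinearMap φ (H.comul a)
        (LinearMap.lTensor A (LinearMap.mul' k A)
          (TensorProduct.assoc k A A A
            (LinearMap.rTensor A (LinearMap.lTensor A H.antipode.toLinearMap)
              (LinearMap.rTensor A H.comul.toLinearMap u)))) =
      Tid φ ((a ⊗ₜ[k] (1 : A)) * LinearMap.rTensor A H.antipode.toLinearMap u) := by
  induction u with
  | zero => simp
  | tmul x y =>
    rw [LinearMap.rTensor_tmul, LinearMap.rTensor_tmul, sliceMul_assoc_tmul,
      AlgHom.toLinearMap_apply, ← H.antipode_comul, ← map_mul, hφ.2]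
    simp
  | add u₁ u₂ h₁ h₂ => simp only [map_add, mul_add, h₁, h₂]

/-- for a left integral `φ`,
`a₍₁₎ φ(a₍₂₎ S(b)) = φ(a S(b₍₁₎)) b₍₂₎`. -/
theorem stmt_1 (k A : Type*) [Field k] [Ring A] [Algebra k A]
    (H : RegularHopfCoquasigroup k A) (φ : A →ₗ[k] k) (hφ : IsLeftIntegral H φ)
    (a b : A) :
    idT φ (H.comul a * ((1 : A) ⊗ₜ[k] H.antipode b)) =
      Tid φ ((a ⊗ₜ[k] (1 : A)) *
        LinearMap.rTensor A H.antipode.toLinearMap (H.comul b)) := by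
  rw [← hφ.sliceMul_comul, H.quasi₃]
  simp
end

section
/- Let A be a regular Hopf coquasigroup over a field k and let φ be a left integral on A. Then for all a, b ∈ A one has a₍₁₎ φ(b a₍₂₎) = S(b₍₁₎) φ(b₍₂₎ a) in A (summations implicit). -/
open TensorProduct

variable {k A : Type*} [Field k] [Ring A] [Algebra k A]

theorem idT_tmul_one_mul (f : A →ₗ[k] k) (x : A) (t : A ⊗[k] A) :
    idT f ((x ⊗ₜ[k] (1 : A)) * t) = x * idT f t := by
  induction t with
  | zero => simp
  | add s t hs ht => simp only [mul_add, map_add, hs, ht]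
  | tmul y z => simp [idT]

theorem rTensor_mul'_assoc_symm_tmul (x : A) (t : A ⊗[k] A) :
    LinearMap.rTensor A (LinearMap.mul' k A) ((TensorProduct.assoc k A A A).symm (x ⊗ₜ[k] t)) =
      (x ⊗ₜ[k] (1 : A)) * t := by
  induction t with
  | zero => simp
  | add s t hs ht => simp only [TensorProduct.tmul_add, mul_add, map_add, hs, ht]
  | tmul y z => simp

theorem IsLeftIntegral.idT_antipode_mul_comul {H : RegularHopfCoquasigroup k A} {φ : A →ₗ[k] k}
    (hφ : IsLeftIntegral H φ) (a : A) (t : A ⊗[k] A) :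
    idT φ (LinearMap.rTensor A (LinearMap.mul' k A)
        ((TensorProduct.assoc k A A A).symm
          ((LinearMap.rTensor (A ⊗[k] A) H.antipode.toLinearMap)
            ((LinearMap.lTensor A H.comul.toLinearMap) t))) * H.comul a) =
      idT φ (LinearMap.rTensor A H.antipode.toLinearMap t * ((1 : A) ⊗ₜ[k] a)) := by
  induction t with
  | zero => simp
  | add s t hs ht => simp only [map_add, add_mul, hs, ht]
  | tmul x y =>
    rw [LinearMap.lTensor_tmul, LinearMap.rTensor_tmul, rTensor_mul'_assoc_symm_tmul,
      AlgHom.toLinearMap_apply, mul_assoc, ← map_mul, idT_tmul_one_mul, hφ.2]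
    simp [idT]

/-- for a left integral `φ`,
`a₍₁₎ φ(b a₍₂₎) = S(b₍₁₎) φ(b₍₂₎ a)`. -/
theorem stmt_2 (k A : Type*) [Field k] [Ring A] [Algebra k A]
    (H : RegularHopfCoquasigroup k A) (φ : A →ₗ[k] k) (hφ : IsLeftIntegral H φ)
    (a b : A) :
    idT φ (((1 : A) ⊗ₜ[k] b) * H.comul a) =
      idT φ (LinearMap.rTensor A H.antipode.toLinearMap (H.comul b) *
        ((1 : A) ⊗ₜ[k] a)) := by
  rw [← H.quasi₁ b]
  exact hφ.idT_antipode_mul_comul a (H.comul b)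
end

section
/- Let A be a regular Hopf coquasigroup over a field k and let ψ be a right integral on A. Then for all a, b ∈ A one has ψ(a₍₁₎ b) a₍₂₎ = ψ(a b₍₁₎) S(b₍₂₎) in A (summations implicit). -/
open TensorProduct

variable {k A : Type*} [Field k] [Ring A] [Algebra k A]

theorem Tid_mul_one_tmul (f : A →ₗ[k] k) (w : A ⊗[k] A) (c : A) :
    Tid f (w * ((1 : A) ⊗ₜ[k] c)) = Tid f w * c := by
  induction w with
  | zero => simp
  | tmul x y => simp [Tid]
  | add x y hx hy => simp [add_mul, hx, hy]

theorem lTensor_mul'_assoc_tmul (u : A ⊗[k] A) (c : A) :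
    LinearMap.lTensor A (LinearMap.mul' k A) (TensorProduct.assoc k A A A (u ⊗ₜ[k] c)) =
      u * ((1 : A) ⊗ₜ[k] c) := by
  induction u with
  | zero => simp
  | tmul x y => simp
  | add x y hx hy => simp [add_mul, TensorProduct.add_tmul, hx, hy]

theorem IsRightIntegral.Tid_lTensor_antipode {H : RegularHopfCoquasigroup k A}
    {ψ : A →ₗ[k] k} (hψ : IsRightIntegral H ψ) (a : A) (t : A ⊗[k] A) :
    Tid ψ (LinearMap.lTensor A H.antipode.toLinearMap ((a ⊗ₜ[k] (1 : A)) * t)) =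
      Tid ψ (H.comul a * LinearMap.lTensor A (LinearMap.mul' k A)
        (TensorProduct.assoc k A A A
          (LinearMap.lTensor (A ⊗[k] A) H.antipode.toLinearMap
            (LinearMap.rTensor A H.comul.toLinearMap t)))) := by
  induction t with
  | zero => simp
  | tmul x y =>
    rw [LinearMap.rTensor_tmul, LinearMap.lTensor_tmul, lTensor_mul'_assoc_tmul, ← mul_assoc,
      Tid_mul_one_tmul, AlgHom.toLinearMap_apply, ← map_mul, hψ.2]
    simp [Tid]
  | add x y hx hy => simp only [mul_add, map_add, hx, hy]

/-- for a right integral `ψ`,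
`ψ(a₍₁₎ b) a₍₂₎ = ψ(a b₍₁₎) S(b₍₂₎)`. -/
theorem stmt_4 (k A : Type*) [Field k] [Ring A] [Algebra k A]
    (H : RegularHopfCoquasigroup k A) (ψ : A →ₗ[k] k) (hψ : IsRightIntegral H ψ)
    (a b : A) :
    Tid ψ (H.comul a * (b ⊗ₜ[k] (1 : A))) =
      Tid ψ (LinearMap.lTensor A H.antipode.toLinearMap
        ((a ⊗ₜ[k] (1 : A)) * H.comul b)) := by
  rw [hψ.Tid_lTensor_antipode, H.quasi₄]
end

section
/- Let A be a regular Hopf coquasigroup over a field k admitting a faithful left integral φ. Then the counit is invariant under the antipode: ε(S(x)) = ε(x) for all x ∈ A. -/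
open TensorProduct

variable {k A : Type*} [Field k] [Ring A] [Algebra k A]

namespace RegularHopfCoquasigroup

/-- `(id ⊗ (ε ∘ S)) ∘ Δ = id`: the functional `ε ∘ S` is a right counit. -/
theorem idT_counit_antipode_comul (H : RegularHopfCoquasigroup k A) (x : A) :
    idT (H.counit.toLinearMap ∘ₗ H.antipode.toLinearMap) (H.comul x) = x := by
  have key : ∀ t : A ⊗[k] A,
      H.antipode (idT (H.counit.toLinearMap ∘ₗ H.antipode.toLinearMap) t) =
        TensorProduct.lid k A (LinearMap.rTensor A H.counit.toLinearMap
          (TensorProduct.map H.antipode.toLinearMap H.antipode.toLinearMap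
            (TensorProduct.comm k A A t))) := by
    intro t
    induction t with
    | zero => simp
    | tmul a b => simp [idT]
    | add u v hu hv => simp only [map_add, hu, hv]
  apply H.antipode.injective
  rw [key, ← H.antipode_comul, H.counit_comul_left]

/-- The counit is invariant under the antipode: `ε ∘ S = ε`. -/
theorem counit_antipode (H : RegularHopfCoquasigroup k A) (x : A) :
    H.counit (H.antipode x) = H.counit x := by
  have key : ∀ t : A ⊗[k] A,
      H.counit (idT (H.counit.toLinearMap ∘ₗ H.antipode.toLinearMap) t) =
        H.counit (H.antipode (TensorProduct.lid k A
          (LinearMap.rTensor A H.counit.toLinearMap t))) := by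
    intro t
    induction t with
    | zero => simp
    | tmul a b => simp [idT, mul_comm]
    | add u v hu hv => simp only [map_add, hu, hv]
  have h := key (H.comul x)
  rw [H.idT_counit_antipode_comul, H.counit_comul_left] at h
  exact h.symm

end RegularHopfCoquasigroup

/-- if `A` admits a faithful left integral, then `ε ∘ S = ε`. -/
theorem stmt_6 (k A : Type*) [Field k] [Ring A] [Algebra k A]
    (H : RegularHopfCoquasigroup k A) (φ : A →ₗ[k] k)
    (hφ : IsLeftIntegral H φ) (hf : Faithful φ) :
    ∀ x : A, H.counit (H.antipode x) = H.counit x := by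
  exact H.counit_antipode
end

section
/- Let A be a regular Hopf coquasigroup over a field k with a faithful left integral φ. Then there exists a nonzero scalar τ ∈ k such that φ(S²(a)) = τ·φ(a) for all a ∈ A, where S² denotes the square of the antipode. -/
open TensorProduct

variable {k A : Type*} [Field k] [Ring A] [Algebra k A]

namespace RegularHopfCoquasigroup

@[simp]
lemma idT_tmul (f : A →ₗ[k] k) (a b : A) : idT f (a ⊗ₜ[k] b) = f b • a := by
  simp [idT]

@[simp]
lemma Tid_tmul (f : A →ₗ[k] k) (a b : A) : Tid f (a ⊗ₜ[k] b) = f a • b := by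
  simp [Tid]

variable (H : RegularHopfCoquasigroup k A)

lemma mul_antipode_assoc (y : A ⊗[k] A) (q : A) :
    (LinearMap.lTensor A (LinearMap.mul' k A))
      ((TensorProduct.assoc k A A A)
        ((LinearMap.lTensor (A ⊗[k] A) H.antipode.toLinearMap) (y ⊗ₜ[k] q))) =
      y * ((1 : A) ⊗ₜ[k] H.antipode q) := by
  induction y with
  | zero => simp
  | tmul a b => simp
  | add y z hy hz => rw [TensorProduct.add_tmul, map_add, map_add, map_add, hy, hz, add_mul]

/-- `ε(a₍₁₎ g(a₍₂₎)) = g(a)`. -/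
lemma counit_idT_comul (g : A →ₗ[k] k) (a : A) :
    H.counit (idT g (H.comul a)) = g a := by
  have h : ∀ x : A ⊗[k] A, H.counit (idT g x) =
      g ((TensorProduct.lid k A) ((LinearMap.rTensor A H.counit.toLinearMap) x)) := by
    intro x
    induction x with
    | zero => simp
    | tmul a b => simp [mul_comm]
    | add y z hy hz => simp only [map_add, hy, hz]
  rw [h, H.counit_comul_left]

lemma Tid_mul_one_tmul (ψ : A →ₗ[k] k) (y : A ⊗[k] A) (c : A) :
    Tid ψ (y * ((1 : A) ⊗ₜ[k] c)) = Tid ψ y * c := by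
  induction y with
  | zero => simp
  | tmul a b => simp
  | add y z hy hz => simp only [map_add, add_mul, hy, hz]

lemma apply_Tid_mul_tmul_one (f ψ : A →ₗ[k] k) (y : A ⊗[k] A) (b : A) :
    f (Tid ψ (y * (b ⊗ₜ[k] (1 : A)))) = ψ (idT f y * b) := by
  induction y with
  | zero => simp
  | tmul a c => simp [mul_comm]
  | add y z hy hz => simp only [map_add, add_mul, hy, hz]

/-- Strong right invariance `ψ(a₍₁₎b) a₍₂₎ = ψ(a b₍₁₎) S(b₍₂₎)`, evaluated at a functional `f`. -/
lemma strong_right_invariance {ψ : A →ₗ[k] k}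
    (hψ : ∀ a : A, Tid ψ (H.comul a) = ψ a • (1 : A)) (f : A →ₗ[k] k) (a b : A) :
    f (Tid ψ (H.comul a * (b ⊗ₜ[k] (1 : A)))) =
      ψ (a * idT (f ∘ₗ H.antipode.toLinearMap) (H.comul b)) := by
  rw [← H.quasi₄ b]
  generalize H.comul b = x
  induction x with
  | zero => simp
  | tmul p q =>
    rw [LinearMap.rTensor_tmul, mul_antipode_assoc, ← mul_assoc, Tid_mul_one_tmul,
      AlgHom.toLinearMap_apply, ← map_mul, hψ]
    simp [mul_comm]
  | add y z hy hz => simp only [map_add, mul_add, hy, hz]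

lemma Tid_comp_antipode_comul (f : A →ₗ[k] k) (a : A) :
    Tid (f ∘ₗ H.antipode.toLinearMap) (H.comul a) =
      H.antipode.symm (idT f (H.comul (H.antipode a))) := by
  rw [H.antipode_comul]
  generalize H.comul a = x
  induction x with
  | zero => simp
  | tmul p q => simp
  | add y z hy hz => simp only [map_add, hy, hz]

lemma idT_comp_antipode_comul (f : A →ₗ[k] k) (a : A) :
    idT (f ∘ₗ H.antipode.toLinearMap) (H.comul a) =
      H.antipode.symm (Tid f (H.comul (H.antipode a))) := by
  rw [H.antipode_comul]
  generalize H.comul a = x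
  induction x with
  | zero => simp
  | tmul p q => simp
  | add y z hy hz => simp only [map_add, hy, hz]

lemma antipode_symm_one : H.antipode.symm 1 = 1 := by
  rw [LinearEquiv.symm_apply_eq, H.antipode_one]

lemma comp_antipode_ne_zero {f : A →ₗ[k] k} (hf : f ≠ 0) :
    f ∘ₗ H.antipode.toLinearMap ≠ 0 := by
  intro h
  apply hf
  ext a
  simpa using LinearMap.congr_fun h (H.antipode.symm a)

lemma _root_.IsLeftIntegral.comp_antipode {H : RegularHopfCoquasigroup k A} {φ : A →ₗ[k] k}
    (hφ : IsLeftIntegral H φ) : IsRightIntegral H (φ ∘ₗ H.antipode.toLinearMap) := by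
  refine ⟨H.comp_antipode_ne_zero hφ.1, fun a => ?_⟩
  rw [Tid_comp_antipode_comul, hφ.2, map_smul, antipode_symm_one]
  simp

lemma _root_.IsRightIntegral.comp_antipode {H : RegularHopfCoquasigroup k A} {ψ : A →ₗ[k] k}
    (hψ : IsRightIntegral H ψ) : IsLeftIntegral H (ψ ∘ₗ H.antipode.toLinearMap) := by
  refine ⟨H.comp_antipode_ne_zero hψ.1, fun a => ?_⟩
  rw [idT_comp_antipode_comul, hψ.2, map_smul, antipode_symm_one]
  simp

/-- Left integrals are unique up to scalars in the presence of a faithful one. -/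
theorem _root_.IsLeftIntegral.exists_eq_mul {H : RegularHopfCoquasigroup k A}
    {φ f : A →ₗ[k] k} (hφ : IsLeftIntegral H φ) (hφf : Faithful φ) (hf : IsLeftIntegral H f) :
    ∃ τ : k, τ ≠ 0 ∧ ∀ a : A, f a = τ * φ a := by
  set ψ := φ ∘ₗ H.antipode.toLinearMap with hψ_def
  have hψ : IsRightIntegral H ψ := hφ.comp_antipode
  set D : A → A := fun b => idT (f ∘ₗ H.antipode.toLinearMap) (H.comul b) with hD
  have key (a b : A) : f a * ψ b = ψ (a * D b) := by
    rw [hD, ← H.strong_right_invariance hψ.2, apply_Tid_mul_tmul_one, hf.2]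
    simp
  have faithful (x : A) (hx : ∀ a, ψ (a * x) = 0) : x = 0 := by
    rw [← H.antipode.map_eq_zero_iff]
    refine hφf.1 _ fun c => ?_
    simpa [hψ_def, H.antipode_mul] using hx (H.antipode.symm c)
  obtain ⟨b₀, hb₀⟩ : ∃ b, ψ b ≠ 0 := by
    by_contra! h
    exact hψ.1 (LinearMap.ext h)
  have hprop (b : A) : ψ b₀ • D b = ψ b • D b₀ := by
    rw [← sub_eq_zero]
    refine faithful _ fun a => ?_
    rw [mul_sub, map_sub, mul_smul_comm, mul_smul_comm, map_smul, map_smul, ← key, ← key,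
      smul_eq_mul, smul_eq_mul]
    ring
  have hmul (a : A) : f a = (f (H.antipode b₀) / ψ b₀) * φ a := by
    have h := congrArg H.counit (hprop (H.antipode.symm a))
    simp only [hD, map_smul, counit_idT_comul, smul_eq_mul] at h
    simp only [hψ_def, LinearMap.comp_apply, LinearEquiv.coe_coe,
      LinearEquiv.apply_symm_apply] at h hb₀ ⊢
    field_simp
    linear_combination h
  refine ⟨_, fun h => hf.1 (LinearMap.ext fun a => ?_), hmul⟩
  rw [hmul, h, zero_mul, LinearMap.zero_apply]

end RegularHopfCoquasigroup

/-- there is `τ ≠ 0` with `φ ∘ S² = τ·φ`. -/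
theorem stmt_10 (k A : Type*) [Field k] [Ring A] [Algebra k A]
    (H : RegularHopfCoquasigroup k A) (φ : A →ₗ[k] k)
    (hφ : IsLeftIntegral H φ) (hf : Faithful φ) :
    ∃ τ : k, τ ≠ 0 ∧ ∀ a : A, φ (H.antipode (H.antipode a)) = τ * φ a := by
  exact hφ.exists_eq_mul hf hφ.comp_antipode.comp_antipode
end

section
/- Let A be a regular Hopf coquasigroup over a field k with a faithful left integral φ, set ψ = φ∘S, and let σ be the (unique) algebra automorphism of A with φ(ab) = φ(b·σ(a)) for all a, b ∈ A. Then there exists a unique algebra automorphism σ' of A such that ψ(ab) = ψ(b·σ'(a)) for all a, b ∈ A; moreover σ' = S⁻¹∘σ⁻¹∘S and ψ(σ'(a)) = ψ(a) for all a ∈ A. -/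
open TensorProduct

variable {k A : Type*} [Field k] [Ring A] [Algebra k A]

/-- The algebra automorphism `S⁻¹ ∘ σ⁻¹ ∘ S`. -/
noncomputable def RegularHopfCoquasigroup.antipodeConj (H : RegularHopfCoquasigroup k A)
    (σ : A ≃ₐ[k] A) : A ≃ₐ[k] A :=
  AlgEquiv.ofLinearEquiv
    (H.antipode.trans (σ.symm.toLinearEquiv.trans H.antipode.symm))
    (by simp [H.antipode_one, LinearEquiv.symm_apply_eq])
    (by
      intro a b
      apply H.antipode.injective
      simp [H.antipode_mul])

@[simp]
theorem RegularHopfCoquasigroup.antipode_antipodeConj (H : RegularHopfCoquasigroup k A)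
    (σ : A ≃ₐ[k] A) (a : A) :
    H.antipode (H.antipodeConj σ a) = σ.symm (H.antipode a) := by
  simp [RegularHopfCoquasigroup.antipodeConj]

/-- with `ψ = φ∘S`, there is a unique automorphism `σ'` with
`ψ(ab) = ψ(b σ'(a))`; moreover `σ' = S⁻¹∘σ⁻¹∘S` and `ψ ∘ σ' = ψ`. -/
theorem stmt_13 (k A : Type*) [Field k] [Ring A] [Algebra k A]
    (H : RegularHopfCoquasigroup k A) (φ : A →ₗ[k] k)
    (hφ : IsLeftIntegral H φ) (hf : Faithful φ)
    (σ : A ≃ₐ[k] A) (hσ : ∀ a b : A, φ (a * b) = φ (b * σ a)) :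
    (∃! σ' : A ≃ₐ[k] A, ∀ a b : A,
      φ (H.antipode (a * b)) = φ (H.antipode (b * σ' a))) ∧
    ∀ σ' : A ≃ₐ[k] A,
      (∀ a b : A, φ (H.antipode (a * b)) = φ (H.antipode (b * σ' a))) →
      ((∀ a : A, σ' a = H.antipode.symm (σ.symm (H.antipode a))) ∧
       ∀ a : A, φ (H.antipode (σ' a)) = φ (H.antipode a)) := by
  have hS : ∀ a b : A, φ (H.antipode b * H.antipode a) =
      φ (σ.symm (H.antipode a) * H.antipode b) := fun a b => by
    rw [hσ (σ.symm (H.antipode a)), AlgEquiv.apply_symm_apply]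
  have huniq : ∀ τ : A ≃ₐ[k] A,
      (∀ a b : A, φ (H.antipode (a * b)) = φ (H.antipode (b * τ a))) →
      ∀ a : A, H.antipode (τ a) = σ.symm (H.antipode a) := by
    intro τ hτ a
    refine sub_eq_zero.mp (hf.1 _ fun c => ?_)
    have h := hτ a (H.antipode.symm c)
    rw [H.antipode_mul, H.antipode_mul, hS, LinearEquiv.apply_symm_apply] at h
    rw [sub_mul, map_sub, h, sub_self]
  refine ⟨⟨H.antipodeConj σ, fun a b => ?_, fun τ hτ => ?_⟩,
    fun τ hτ => ⟨fun a => ?_, fun a => ?_⟩⟩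
  · rw [H.antipode_mul, H.antipode_mul, H.antipode_antipodeConj, hS]
  · ext a
    apply H.antipode.injective
    rw [huniq τ hτ, H.antipode_antipodeConj]
  · rw [← huniq τ hτ, LinearEquiv.symm_apply_apply]
  · simpa using (hτ a 1).symm
end
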